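/- Let K ⊂ ℝ^d be a nonempty compact set with lower dimension β = dim_L K. Then there exists a weak tangent F ∈ Tan(K) whose β-dimensional packing pre-measure satisfies P₀^β(F) ≤ 257^β < ∞. -/

import Mathlib

open Metric Filter
open scoped ENNReal

/-- The covering number `N_r(F)`. -/
noncomputable def coverNum {X : Type*} [MetricSpace X] (r : ℝ) (F : Set X) : ℕ∞ :=
  sInf ((fun S : Finset X => (S.card : ℕ∞)) ''
    {S : Finset X | ↑S ⊆ F ∧ F ⊆ ⋃ x ∈ S, closedBall x r})

/-- The lower dimension of a set. -/
noncomputable def lowerDim {X : Type*} [MetricSpace X] (K : Set X) : ℝ :=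
  sSup {α : ℝ | 0 < α ∧ ∃ C : ℝ, 0 < C ∧ ∀ r R : ℝ, 0 < r → r ≤ R → R < 1 → ∀ x ∈ K,
    ENNReal.ofReal (C * (R / r) ^ α) ≤ (coverNum r (closedBall x R ∩ K) : ℝ≥0∞)}

/-- The `s`-dimensional packing pre-measure. -/
noncomputable def packingPre {X : Type*} [MetricSpace X] (s : ℝ) (E : Set X) : ℝ≥0∞ :=
  ⨅ (δ : ℝ) (_ : 0 < δ),
    ⨆ (n : ℕ) (c : Fin n → X) (r : Fin n → ℝ) (_ : ∀ i, c i ∈ E)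
      (_ : ∀ i, 0 < r i ∧ r i ≤ δ)
      (_ : ∀ i j, i ≠ j → Disjoint (closedBall (c i) (r i)) (closedBall (c j) (r j))),
      ∑ i, ENNReal.ofReal ((2 * r i) ^ s)

/-- The miniset `λ(K - x) ∩ B(0,1)`. -/
def miniset {d : ℕ} (K : Set (EuclideanSpace ℝ (Fin d))) (x : EuclideanSpace ℝ (Fin d))
    (lam : ℝ) : Set (EuclideanSpace ℝ (Fin d)) :=
  (fun y => lam • (y - x)) '' K ∩ closedBall 0 1

/-- A weak tangent of `K`: a Hausdorff-metric limit of minisets `λₙ(K - xₙ) ∩ B(0,1)`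
with `xₙ ∈ K`, `λₙ ≥ 1` and `λₙ → ∞`. -/
def IsWeakTangent {d : ℕ} (K E : Set (EuclideanSpace ℝ (Fin d))) : Prop :=
  E.Nonempty ∧ IsCompact E ∧ ∃ (x : ℕ → EuclideanSpace ℝ (Fin d)) (lam : ℕ → ℝ),
    (∀ n, x n ∈ K) ∧ (∀ n, 1 ≤ lam n) ∧ Filter.Tendsto lam Filter.atTop Filter.atTop ∧
    (∀ n, (miniset K (x n) (lam n)).Nonempty) ∧
    Filter.Tendsto (fun n => hausdorffDist (miniset K (x n) (lam n)) E)
      Filter.atTop (nhds 0)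

lemma card_le_coverNum {X : Type*} [MetricSpace X] {r : ℝ} {F : Set X} (P : Finset X)
    (hP : ↑P ⊆ F) (hsep : ∀ p ∈ P, ∀ q ∈ P, p ≠ q → 2 * r < dist p q) :
    (P.card : ℕ∞) ≤ coverNum r F := by
  unfold coverNum
  apply le_sInf
  rintro _ ⟨S, ⟨hS, hc⟩, rfl⟩
  have h : ∀ p ∈ P, ∃ x ∈ S, dist p x ≤ r := by
    intro p hp
    have := hc (hP hp)
    simpa using this
  choose! f hf hd using h
  simp only [Nat.cast_le]
  apply Finset.card_le_card_of_injOn f hf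
  intro p hp q hq hpq
  by_contra hne
  have h1 := hsep p hp q hq hne
  have h2 := hd p hp
  have h3 := hd q hq
  rw [← hpq] at h3
  have := dist_triangle_right p q (f p)
  linarith

/-- every ball of radius at most `τ` contains well separated smaller balls. -/
def Good {X : Type*} [MetricSpace X] (K : Set X) (τ s : ℝ) : Prop :=
  ∀ x ∈ K, ∀ R : ℝ, 0 < R → R ≤ τ → ∃ (m : ℕ) (y : Fin m → X) (t : Fin m → ℝ),
    (∀ i, y i ∈ K ∧ dist (y i) x ≤ R / 2 ∧ τ ≤ t i ∧ t i ≤ 1 / 16) ∧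
    (∀ i j, i ≠ j → 2 * R * (t i + t j) ≤ dist (y i) (y j)) ∧ 1 ≤ ∑ i, t i ^ s

lemma tree {X : Type*} [MetricSpace X] {K : Set X} {τ s r : ℝ} (hG : Good K τ s)
    (hτ : 0 < τ) (hs : 0 < s) (hr : 0 < r) (n : ℕ) : ∀ x ∈ K, ∀ R : ℝ, 0 < R → R ≤ τ →
    τ * R ≤ r * 2 ^ n → ∃ P : Finset X, (∀ p ∈ P, p ∈ K ∧ dist p x ≤ R) ∧
      (∀ p ∈ P, ∀ q ∈ P, p ≠ q → 2 * r < dist p q) ∧ (τ * R / r) ^ s ≤ P.card := by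
  classical
  have base : ∀ x ∈ K, ∀ R : ℝ, 0 < R → τ * R ≤ r → 
      ∃ P : Finset X, (∀ p ∈ P, p ∈ K ∧ dist p x ≤ R) ∧
      (∀ p ∈ P, ∀ q ∈ P, p ≠ q → 2 * r < dist p q) ∧ (τ * R / r) ^ s ≤ P.card := by
    intro x hx R hR h
    refine ⟨{x}, ?_, ?_, ?_⟩
    · simp [hx, hR.le]
    · simp
    · simp only [Finset.card_singleton, Nat.cast_one]
      apply Real.rpow_le_one (by positivity) _ hs.le
      rw [div_le_one hr]; exact h
  induction n with
  | zero =>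
    intro x hx R hR _ h
    exact base x hx R hR (by simpa using h)
  | succ n ih =>
    intro x hx R hR hRτ h
    by_cases hb : τ * R ≤ r
    · exact base x hx R hR hb
    push Not at hb
    obtain ⟨m, y, t, h1, h2, h3⟩ := hG x hx R hR hRτ
    have ht : ∀ i, 0 < t i := fun i => hτ.trans_le (h1 i).2.2.1
    have hch : ∀ i, ∃ P : Finset X, (∀ p ∈ P, p ∈ K ∧ dist p (y i) ≤ t i * R) ∧
      (∀ p ∈ P, ∀ q ∈ P, p ≠ q → 2 * r < dist p q) ∧ (τ * (t i * R) / r) ^ s ≤ P.card := by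
      intro i
      have h16 : t i * R ≤ 1 / 16 * R := mul_le_mul_of_nonneg_right (h1 i).2.2.2 hR.le
      apply ih (y i) (h1 i).1 (t i * R) (mul_pos (ht i) hR)
      · linarith
      · rw [pow_succ] at h
        have := mul_le_mul_of_nonneg_left h16 hτ.le
        nlinarith [mul_pos hτ hR]
    choose P hP1 hP2 hP3 using hch
    have gap : ∀ i j, i ≠ j → ∀ p ∈ P i, ∀ q ∈ P j, 2 * r < dist p q := by
      intro i j hij p hp q hq
      have a := h2 i j hij
      have b := (hP1 i p hp).2
      have c := (hP1 j q hq).2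
      have d1 := dist_triangle4_left p q (y i) (y j)
      have d2 := dist_triangle4 (y i) p q (y j)
      rw [dist_comm (y i) p] at d2
      have e1 := mul_le_mul_of_nonneg_right (h1 i).2.2.1 hR.le
      have e2 := mul_le_mul_of_nonneg_right (h1 j).2.2.1 hR.le
      nlinarith
    refine ⟨Finset.univ.biUnion P, ?_, ?_, ?_⟩
    · intro p hp
      simp only [Finset.mem_biUnion, Finset.mem_univ, true_and] at hp
      obtain ⟨i, hi⟩ := hp
      refine ⟨(hP1 i p hi).1, ?_⟩
      have := dist_triangle p (y i) x
      have a := (hP1 i p hi).2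
      have b := (h1 i).2.1
      have h16 : t i * R ≤ 1 / 16 * R := mul_le_mul_of_nonneg_right (h1 i).2.2.2 hR.le
      linarith
    · intro p hp q hq hpq
      simp only [Finset.mem_biUnion, Finset.mem_univ, true_and] at hp hq
      obtain ⟨i, hi⟩ := hp
      obtain ⟨j, hj⟩ := hq
      by_cases hij : i = j
      · subst hij
        exact hP2 i p hi q hj hpq
      · exact gap i j hij p hi q hj
    · rw [Finset.card_biUnion]
      · push_cast
        calc (τ * R / r) ^ s ≤ (∑ i, t i ^ s) * (τ * R / r) ^ s :=
              le_mul_of_one_le_left (by positivity) h3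
          _ = ∑ i, (τ * (t i * R) / r) ^ s := by
              rw [Finset.sum_mul]
              refine Finset.sum_congr rfl fun i _ => ?_
              rw [← Real.mul_rpow (ht i).le (by positivity)]
              congr 1; ring
          _ ≤ _ := Finset.sum_le_sum fun i _ => hP3 i
      · intro i _ j _ hij
        change Disjoint (P i) (P j)
        rw [Finset.disjoint_left]
        intro p hp hq
        have := gap i j hij p hp p hq
        simp at this
        linarith

/-- The set whose supremum is the lower dimension. -/
def lowerDimSet {X : Type*} [MetricSpace X] (K : Set X) : Set ℝ :=
  {α : ℝ | 0 < α ∧ ∃ C : ℝ, 0 < C ∧ ∀ r R : ℝ, 0 < r → r ≤ R → R < 1 → ∀ x ∈ K,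
    ENNReal.ofReal (C * (R / r) ^ α) ≤ (coverNum r (closedBall x R ∩ K) : ℝ≥0∞)}

lemma mem_of_good {X : Type*} [MetricSpace X] {K : Set X} {τ s : ℝ} (hG : Good K τ s)
    (hτ : 0 < τ) (hτ1 : τ ≤ 1) (hs : 0 < s) : s ∈ lowerDimSet K := by
  refine ⟨hs, (τ * τ) ^ s, by positivity, ?_⟩
  intro r R hr hrR hR x hx
  have hRp : 0 < R := hr.trans_le hrR
  have hτR : 0 < τ * R := by positivity
  have hτR1 : τ * R ≤ τ := by nlinarith
  have hτR2 : τ * R ≤ R := by nlinarith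
  obtain ⟨n, hn⟩ := pow_unbounded_of_one_lt (τ * (τ * R) / r) (one_lt_two)
  rw [div_lt_iff₀ hr] at hn
  obtain ⟨P, h1, h2, h3⟩ := tree hG hτ hs hr n x hx (τ * R) hτR hτR1 (by linarith)
  have h4 := card_le_coverNum (F := closedBall x R ∩ K) P
    (fun p hp => ⟨by simpa using (h1 p hp).2.trans hτR2, (h1 p hp).1⟩) h2
  have h5 : ((P.card : ℕ∞) : ℝ≥0∞) ≤ (coverNum r (closedBall x R ∩ K) : ℝ≥0∞) := by
    exact_mod_cast h4
  refine le_trans ?_ h5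
  rw [← Real.mul_rpow (by positivity) (by positivity)]
  have : τ * τ * (R / r) = τ * (τ * R) / r := by ring
  rw [this]
  have := ENNReal.ofReal_le_ofReal h3
  simpa using this

lemma coverNum_le {X : Type*} [MetricSpace X] {r : ℝ} (hr : 0 < r) {F : Set X} (n : ℕ)
    (h : ∀ P : Finset X, ↑P ⊆ F → (∀ p ∈ P, ∀ q ∈ P, p ≠ q → r < dist p q) → P.card ≤ n) :
    coverNum r F ≤ n := by
  classical
  let A : Set ℕ := {k | ∃ P : Finset X, ↑P ⊆ F ∧
    (∀ p ∈ P, ∀ q ∈ P, p ≠ q → r < dist p q) ∧ P.card = k}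
  have hA : A.Nonempty := ⟨0, ∅, by simp, by simp, rfl⟩
  have hb : BddAbove A := ⟨n, by rintro k ⟨P, h1, h2, rfl⟩; exact h P h1 h2⟩
  obtain ⟨P, h1, h2, h3⟩ := Nat.sSup_mem hA hb
  have hPn := h P h1 h2
  refine le_trans (b := (P.card : ℕ∞)) ?_ (by exact_mod_cast hPn)
  refine sInf_le ⟨P, ⟨h1, ?_⟩, rfl⟩
  intro z hz
  by_contra hcon
  simp only [Set.mem_iUnion, mem_closedBall, exists_prop, not_exists, not_and, not_le] at hcon
  have hzP : z ∉ P := fun hzP => by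
    have := hcon z hzP
    simp at this
    linarith
  have : (insert z P).card ∈ A := by
    refine ⟨insert z P, ?_, ?_, rfl⟩
    · intro w hw
      rcases Finset.mem_insert.1 hw with rfl | hw
      · exact hz
      · exact h1 hw
    · intro p hp q hq hpq
      rcases Finset.mem_insert.1 hp with rfl | hpP
      · rcases Finset.mem_insert.1 hq with rfl | hqP
        · exact absurd rfl hpq
        · exact hcon q hqP
      · rcases Finset.mem_insert.1 hq with rfl | hqP
        · rw [dist_comm]; exact hcon p hpP
        · exact h2 p hpP q hqP hpq
  have := le_csSup hb this
  rw [Finset.card_insert_of_notMem hzP, h3] at this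
  omega

open MeasureTheory in
lemma card_sep_le {d : ℕ} (x : EuclideanSpace ℝ (Fin d)) {r R : ℝ} (hr : 0 < r) (hR : r ≤ R)
    (P : Finset (EuclideanSpace ℝ (Fin d))) (hP : ↑P ⊆ closedBall x R)
    (hsep : ∀ p ∈ P, ∀ q ∈ P, p ≠ q → r < dist p q) : (P.card : ℝ) ≤ (4 * (R / r)) ^ d := by
  have hRp : 0 < R := hr.trans_le hR
  have hd : Module.finrank ℝ (EuclideanSpace ℝ (Fin d)) = d := by simp
  have hsum : ∑ p ∈ P, volume (ball p (r / 2)) ≤ volume (ball x (R + r)) := by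
    rw [← measure_biUnion_finset]
    · apply measure_mono
      intro z hz
      simp only [Set.mem_iUnion, mem_ball, exists_prop] at hz ⊢
      obtain ⟨p, hp, hz⟩ := hz
      have := hP hp
      rw [mem_closedBall] at this
      have := dist_triangle z p x
      linarith
    · intro p hp q hq hpq
      change Disjoint (ball p (r / 2)) (ball q (r / 2))
      apply ball_disjoint_ball
      have := hsep p hp q hq hpq
      linarith
    · intro p _; exact measurableSet_ball
  simp_rw [Measure.addHaar_ball_of_pos volume _ (show 0 < r / 2 by linarith)] at hsum
  rw [Measure.addHaar_ball_of_pos volume _ (show 0 < R + r by linarith), hd] at hsum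
  have hv0 : volume (ball (0 : EuclideanSpace ℝ (Fin d)) 1) ≠ 0 := (measure_ball_pos _ _ one_pos).ne'
  have hvt : volume (ball (0 : EuclideanSpace ℝ (Fin d)) 1) ≠ ⊤ := measure_ball_lt_top.ne
  rw [Finset.sum_const, nsmul_eq_mul, ← mul_assoc, ENNReal.mul_le_mul_iff_left hv0 hvt,
    ← ENNReal.ofReal_natCast, ← ENNReal.ofReal_mul (by positivity),
    ENNReal.ofReal_le_ofReal_iff (by positivity)] at hsum
  rw [← le_div_iff₀ (by positivity), ← div_pow] at hsum
  refine hsum.trans (pow_le_pow_left₀ (by positivity) ?_ d)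
  rw [div_le_iff₀ (by positivity)]
  have : 4 * (R / r) * (r / 2) = 2 * R := by field_simp; norm_num
  linarith

lemma bdd_lower {d : ℕ} {K : Set (EuclideanSpace ℝ (Fin d))} (hne : K.Nonempty) :
    BddAbove (lowerDimSet K) := by
  obtain ⟨x, hx⟩ := hne
  refine ⟨d, ?_⟩
  rintro α ⟨hα, C, hC, h⟩
  by_contra hlt
  push Not at hlt
  have key : ∀ y : ℝ, 1 ≤ y → C * y ^ (α - d) ≤ 4 ^ d + 1 := by
    intro y hy
    have hy0 : 0 < y := by linarith
    have h1 := h (1 / 2 / y) (1 / 2) (by positivity)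
      (div_le_self (by norm_num) hy) (by norm_num) x hx
    have e : (1 / 2 : ℝ) / (1 / 2 / y) = y := by field_simp
    rw [e] at h1
    have h2 := coverNum_le (r := 1 / 2 / y) (F := closedBall x (1 / 2) ∩ K) (by positivity)
      ⌊(4 * y) ^ d⌋₊ (by
        intro P hP hs
        apply Nat.le_floor
        have := card_sep_le x (r := 1 / 2 / y) (by positivity) (div_le_self (by norm_num) hy) P
          (fun p hp => (hP hp).1) hs
        rwa [e] at this)
    have h3 : (coverNum (1 / 2 / y) (closedBall x (1 / 2) ∩ K) : ℝ≥0∞) ≤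
        ((⌊(4 * y) ^ d⌋₊ : ℕ) : ℝ≥0∞) := by exact_mod_cast h2
    have h4 := h1.trans h3
    rw [← ENNReal.ofReal_natCast, ENNReal.ofReal_le_ofReal_iff (by positivity)] at h4
    have h5 := h4.trans (Nat.floor_le (by positivity))
    rw [mul_pow] at h5
    rw [Real.rpow_sub hy0, Real.rpow_natCast, ← mul_div_assoc]
    rw [div_le_iff₀ (by positivity)]
    have : 0 < y ^ d := by positivity
    linarith
  have ht := (tendsto_rpow_atTop (sub_pos.2 hlt)).const_mul_atTop hC
  obtain ⟨y, hy1, hy2⟩ := ((ht.eventually_gt_atTop (4 ^ d + 1)).and (eventually_ge_atTop 1)).exists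
  exact absurd (key y hy2) (not_le.2 hy1)

lemma zero_mem_miniset {d : ℕ} {K : Set (EuclideanSpace ℝ (Fin d))}
    {x : EuclideanSpace ℝ (Fin d)} (hx : x ∈ K) (l : ℝ) : 0 ∈ miniset K x l :=
  ⟨⟨x, hx, by simp⟩, by simp⟩

lemma isCompact_miniset {d : ℕ} {K : Set (EuclideanSpace ℝ (Fin d))} (hK : IsCompact K)
    (x : EuclideanSpace ℝ (Fin d)) (l : ℝ) : IsCompact (miniset K x l) :=
  (hK.image (by fun_prop)).inter_right isClosed_closedBall

lemma exists_limit {d : ℕ} (M : ℕ → Set (EuclideanSpace ℝ (Fin d))) (hne : ∀ n, (M n).Nonempty)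
    (hc : ∀ n, IsCompact (M n)) (hb : ∀ n, M n ⊆ closedBall 0 1) :
    ∃ F : Set (EuclideanSpace ℝ (Fin d)), F.Nonempty ∧ IsCompact F ∧ ∃ φ : ℕ → ℕ, StrictMono φ ∧
      Tendsto (fun n => hausdorffDist (M (φ n)) F) atTop (nhds 0) := by
  let B := closedBall (0 : EuclideanSpace ℝ (Fin d)) 1
  have : CompactSpace B := isCompact_iff_compactSpace.1 (isCompact_closedBall _ _)
  have him : ∀ n, (Subtype.val '' (Subtype.val ⁻¹' M n : Set B)) = M n := fun n => by
    rw [Subtype.image_preimage_coe]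
    exact Set.inter_eq_right.2 (hb n)
  let u : ℕ → TopologicalSpace.NonemptyCompacts B := fun n =>
    ⟨⟨Subtype.val ⁻¹' M n, ((hc n).isClosed.preimage continuous_subtype_val).isCompact⟩, by
      obtain ⟨z, hz⟩ := hne n
      exact ⟨⟨z, hb n hz⟩, hz⟩⟩
  obtain ⟨G, φ, hφ, hlim⟩ := CompactSpace.tendsto_subseq u
  refine ⟨Subtype.val '' (G : Set B), G.nonempty.image _, G.isCompact.image continuous_subtype_val,
    φ, hφ, ?_⟩
  rw [tendsto_iff_dist_tendsto_zero] at hlim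
  refine hlim.congr fun n => ?_
  rw [NonemptyCompacts.dist_eq, ← him (φ n), hausdorffDist_image isometry_subtype_coe]
  rfl

lemma exists_packing {X : Type*} [MetricSpace X] {s : ℝ} {E : Set X} {A : ℝ≥0∞}
    (h : A < packingPre s E) : ∃ (n : ℕ) (c : Fin n → X) (r : Fin n → ℝ), (∀ i, c i ∈ E) ∧
      (∀ i, 0 < r i ∧ r i ≤ 1) ∧
      (∀ i j, i ≠ j → Disjoint (closedBall (c i) (r i)) (closedBall (c j) (r j))) ∧
      A < ∑ i, ENNReal.ofReal ((2 * r i) ^ s) := by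
  have h1 := h.trans_le (iInf₂_le (1 : ℝ) one_pos)
  simp only [lt_iSup_iff] at h1
  obtain ⟨n, c, r, a, b, e, f⟩ := h1
  exact ⟨n, c, r, a, b, e, f⟩

lemma exists_good {d : ℕ} {K : Set (EuclideanSpace ℝ (Fin d))} (hK : IsCompact K) {β : ℝ}
    (hβ : 0 ≤ β)
    (H : ∀ F, IsWeakTangent K F → ENNReal.ofReal ((257 : ℝ) ^ β) < packingPre β F) :
    ∃ n : ℕ, Good K (1 / ((n : ℝ) + 1)) (β + 1 / ((n : ℝ) + 1)) := by
  by_contra hcon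
  push Not at hcon
  unfold Good at hcon
  push Not at hcon
  choose x hx R hR hRn hbad using hcon
  have hlam : ∀ n : ℕ, (n : ℝ) + 1 ≤ 2 / R n := by
    intro n
    have hp : (0 : ℝ) < n + 1 := by positivity
    have h1 := hRn n
    rw [le_div_iff₀ hp] at h1
    rw [le_div_iff₀ (hR n)]
    linarith
  obtain ⟨F, hF1, hF2, φ, hφ, hlim⟩ := exists_limit (fun n => miniset K (x n) (2 / R n))
    (fun n => ⟨0, zero_mem_miniset (hx n) _⟩) (fun n => isCompact_miniset hK _ _)
    (fun n => Set.inter_subset_right)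
  have hW : IsWeakTangent K F := by
    refine ⟨hF1, hF2, fun n => x (φ n), fun n => 2 / R (φ n), fun n => hx _, fun n => ?_, ?_,
      fun n => ⟨0, zero_mem_miniset (hx _) _⟩, hlim⟩
    · have := hlam (φ n)
      have h0 : (0 : ℝ) ≤ φ n := by positivity
      linarith
    · have : Tendsto (fun n => 2 / R n) atTop atTop :=
        tendsto_atTop_mono (fun n => (by linarith [hlam n] : (n : ℝ) ≤ 2 / R n))
          tendsto_natCast_atTop_atTop
      exact this.comp hφ.tendsto_atTop
  obtain ⟨m, c, r, hc, hr, hdisj, hsum⟩ := exists_packing (H F hW)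
  have hsum1 : 1 < ∑ i, (r i / 16) ^ β := by
    rw [← ENNReal.ofReal_sum_of_nonneg
      (fun i _ => Real.rpow_nonneg (by linarith [(hr i).1]) _)] at hsum
    have h1 := (ENNReal.ofReal_lt_ofReal_iff_of_nonneg (by positivity)).1 hsum
    have h2 : ∑ i, (2 * r i) ^ β = 32 ^ β * ∑ i, (r i / 16) ^ β := by
      rw [Finset.mul_sum]
      refine Finset.sum_congr rfl fun i _ => ?_
      rw [← Real.mul_rpow (by norm_num) (by linarith [(hr i).1])]
      congr 1; ring
    have h3 : (32 : ℝ) ^ β ≤ 257 ^ β := Real.rpow_le_rpow (by norm_num) (by norm_num) hβ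
    have h4 : (0 : ℝ) < 32 ^ β := by positivity
    rw [h2] at h1
    by_contra h5
    push Not at h5
    nlinarith
  have hτ : Tendsto (fun n => 1 / ((φ n : ℝ) + 1)) atTop (nhds 0) :=
    tendsto_one_div_add_atTop_nhds_zero_nat.comp hφ.tendsto_atTop
  have hcont : Tendsto (fun n => ∑ i, (r i / 16) ^ (β + 1 / ((φ n : ℝ) + 1))) atTop
      (nhds (∑ i, (r i / 16) ^ β)) := by
    refine tendsto_finsetSum _ fun i _ => ?_
    have h1 : Tendsto (fun n => β + 1 / ((φ n : ℝ) + 1)) atTop (nhds β) := by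
      simpa using hτ.const_add β
    exact tendsto_const_nhds.rpow h1 (Or.inl (by have := (hr i).1; positivity))
  have e1 := hcont.eventually_const_lt hsum1
  have e2 : ∀ᶠ n in atTop, ∀ i, 1 / ((φ n : ℝ) + 1) < r i / 16 := by
    rw [eventually_all]
    intro i
    exact hτ.eventually_lt_const (by linarith [(hr i).1])
  have e3 : ∀ᶠ n in atTop, ∀ i, hausdorffDist (miniset K (x (φ n)) (2 / R (φ n))) F < r i / 4 := by
    rw [eventually_all]
    intro i
    exact hlim.eventually_lt_const (by linarith [(hr i).1])
  obtain ⟨n, h1, h2, h3⟩ := (e1.and (e2.and e3)).exists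
  set k := φ n with hk
  have hcomp := isCompact_miniset hK (x k) (2 / R k)
  have hfin : hausdorffEDist (miniset K (x k) (2 / R k)) F ≠ ⊤ :=
    hausdorffEDist_ne_top_of_nonempty_of_bounded ⟨0, zero_mem_miniset (hx k) _⟩ hF1
      hcomp.isBounded hF2.isBounded
  have hpos := hR k
  have hpt : ∀ i, ∃ y ∈ K, dist y (x k) ≤ R k / 2 ∧
      ∀ j, dist ((2 / R k) • (y - x k)) (c i) < r j / 4 := by
    intro i
    obtain ⟨j0, -, hj0⟩ := Finset.exists_min_image Finset.univ r ⟨i, Finset.mem_univ i⟩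
    obtain ⟨z, ⟨⟨y, hy, rfl⟩, hzb⟩, hz⟩ :=
      exists_dist_lt_of_hausdorffDist_lt' (hc i) (h3 j0) hfin
    refine ⟨y, hy, ?_, fun j => ?_⟩
    · rw [mem_closedBall, dist_zero_right, norm_smul, Real.norm_of_nonneg (by positivity),
        ← dist_eq_norm] at hzb
      rw [div_mul_eq_mul_div, div_le_one hpos] at hzb
      linarith
    · have := hj0 j (Finset.mem_univ j)
      have hz2 : dist ((2 / R k) • (y - x k)) (c i) < r j0 / 4 := hz
      linarith
  choose y hyK hyx hyc using hpt
  have := hbad k m y (fun i => r i / 16) (fun i => ⟨hyK i, hyx i, (h2 i).le, by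
    have := (hr i).2
    linarith⟩) (fun i j hij => by
      have a1 : r i < dist (c j) (c i) := by
        by_contra hle
        push Not at hle
        exact Set.disjoint_left.1 (hdisj i j hij) (mem_closedBall.2 hle)
          (mem_closedBall_self (hr j).1.le)
      have a2 : r j < dist (c i) (c j) := by
        by_contra hle
        push Not at hle
        exact Set.disjoint_left.1 (hdisj i j hij) (mem_closedBall_self (hr i).1.le)
          (mem_closedBall.2 hle)
      rw [dist_comm] at a1
      have a3 : dist ((2 / R k) • (y i - x k)) ((2 / R k) • (y j - x k)) =
          2 / R k * dist (y i) (y j) := by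
        rw [dist_smul₀, Real.norm_of_nonneg (by positivity), dist_sub_right]
      have a4 := dist_triangle4 (c i) ((2 / R k) • (y i - x k)) ((2 / R k) • (y j - x k)) (c j)
      rw [a3, dist_comm (c i) ((2 / R k) • (y i - x k))] at a4
      have b1 := hyc i i
      have b2 := hyc j j
      have b3 : (r i + r j) / 4 ≤ 2 / R k * dist (y i) (y j) := by linarith
      rw [div_mul_eq_mul_div, le_div_iff₀ hpos] at b3
      linarith)
  exact absurd h1 (not_lt.2 this.le)

theorem statement12 {d : ℕ} (K : Set (EuclideanSpace ℝ (Fin d)))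
    (hne : K.Nonempty) (hK : IsCompact K) :
    ∃ F : Set (EuclideanSpace ℝ (Fin d)), IsWeakTangent K F ∧
      packingPre (lowerDim K) F ≤ ENNReal.ofReal ((257 : ℝ) ^ lowerDim K) ∧
      packingPre (lowerDim K) F < ⊤ := by
  by_contra hcon
  have hβ : 0 ≤ lowerDim K := Real.sSup_nonneg fun α hα => hα.1.le
  obtain ⟨n, hn⟩ := exists_good hK hβ (fun F hF => by
    by_contra hle
    push Not at hle
    exact hcon ⟨F, hF, hle, hle.trans_lt ENNReal.ofReal_lt_top⟩)
  have hpos : (0 : ℝ) < 1 / ((n : ℝ) + 1) := by positivity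
  have h1 : 1 / ((n : ℝ) + 1) ≤ 1 := by
    rw [div_le_one (by positivity)]
    have : (0 : ℝ) ≤ n := by positivity
    linarith
  have hmem := mem_of_good hn hpos h1 (by linarith)
  have hle : lowerDim K + 1 / ((n : ℝ) + 1) ≤ lowerDim K := le_csSup (bdd_lower hne) hmem
  linarith
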